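/- Let d be a positive integer and let J ⊊ I be squarefree monomial ideals of S such that I is generated by squarefree monomials of degrees ≥ d and J is either 0 or generated by squarefree monomials of degrees ≥ d+1. If sdepth_S I/J = d, then depth_S I/J = d. -/

import Mathlib

open MvPolynomial

/-- The squarefree monomial `∏_{i ∈ T} x_i` in `K[x_1,…,x_n]`. -/
noncomputable def sqm (K : Type*) [Field K] {n : ℕ} (T : Finset (Fin n)) :
    MvPolynomial (Fin n) K := ∏ i ∈ T, X i

/-- The poset `P_{I \ J}` of (supports of) squarefree monomials of `I \ J`. -/
def sqPoset {K : Type*} [Field K] {n : ℕ} (I J : Ideal (MvPolynomial (Fin n) K)) :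
    Set (Finset (Fin n)) :=
  {T | sqm K T ∈ I ∧ sqm K T ∉ J}

/-- The squarefree monomials of degree `k` in `I \ J`. -/
def degSet {K : Type*} [Field K] {n : ℕ} (I J : Ideal (MvPolynomial (Fin n) K)) (k : ℕ) :
    Set (Finset (Fin n)) :=
  {T ∈ sqPoset I J | T.card = k}

/-- A partition of `P_{I\J}` into intervals `[u,v]`, recorded as a finite set of
pairs `(u, v)`: each monomial of `P_{I\J}` lies in exactly one interval. -/
def IsIntervalPartition {K : Type*} [Field K] {n : ℕ}
    (I J : Ideal (MvPolynomial (Fin n) K))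
    (F : Finset (Finset (Fin n) × Finset (Fin n))) : Prop :=
  (∀ p ∈ F, p.1 ∈ sqPoset I J ∧ p.2 ∈ sqPoset I J ∧ p.1 ⊆ p.2) ∧
  (∀ T ∈ sqPoset I J, ∃! p, p ∈ F ∧ p.1 ⊆ T ∧ T ⊆ p.2)

/-- The Stanley depth of `I/J`: the maximum over interval partitions of the
minimal degree of an upper endpoint. -/
noncomputable def sdepth {K : Type*} [Field K] {n : ℕ}
    (I J : Ideal (MvPolynomial (Fin n) K)) : ℕ :=
  sSup {k | ∃ F, IsIntervalPartition I J F ∧ ∀ p ∈ F, k ≤ p.2.card}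

/-- The depth of a module over `K[x_1,…,x_n]` with respect to the maximal ideal
`(x_1,…,x_n)`: the supremum of lengths of regular sequences from `(x_1,…,x_n)`. -/
noncomputable def mdepth {K : Type*} [Field K] {n : ℕ}
    (M : Type*) [AddCommGroup M] [Module (MvPolynomial (Fin n) K) M] : ℕ :=
  sSup {k | ∃ rs : List (MvPolynomial (Fin n) K), rs.length = k ∧
    (∀ r ∈ rs, r ∈ Ideal.span (Set.range X : Set (MvPolynomial (Fin n) K))) ∧
    RingTheory.Sequence.IsRegular M rs}

/-- The `S`-module `I/J` (more precisely `I/(J ∩ I)`). -/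
abbrev quotMod {K : Type*} [Field K] {n : ℕ} (I J : Ideal (MvPolynomial (Fin n) K)) :=
  I ⧸ (Submodule.comap I.subtype J)

/-- `depth_S I/J`. -/
noncomputable def depthIJ {K : Type*} [Field K] {n : ℕ}
    (I J : Ideal (MvPolynomial (Fin n) K)) : ℕ :=
  mdepth (K := K) (n := n) (quotMod I J)

/-- An ideal is a squarefree monomial ideal generated in degrees `≥ d` if it is
the span of squarefree monomials whose supports have at least `d` elements. -/
def SqfreeGenFrom {K : Type*} [Field K] {n : ℕ}
    (L : Ideal (MvPolynomial (Fin n) K)) (d : ℕ) : Prop :=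
  ∃ G : Set (Finset (Fin n)), (∀ T ∈ G, d ≤ T.card) ∧ L = Ideal.span (sqm K '' G)

/-- A squarefree monomial ideal. -/
def IsSqfreeMonomialIdeal {K : Type*} [Field K] {n : ℕ}
    (L : Ideal (MvPolynomial (Fin n) K)) : Prop :=
  ∃ G : Set (Finset (Fin n)), L = Ideal.span (sqm K '' G)

section Koszul

open Finset

variable {ι R M : Type*} [LinearOrder ι] [CommRing R] [AddCommGroup M] [Module R M]

/-- The sign of `i` relative to `T` in the Koszul complex. -/
def koszulSign (R : Type*) [CommRing R] (i : ι) (T : Finset ι) : R :=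
  (-1) ^ #{j ∈ T | j < i}

lemma koszulSign_mul_self (i : ι) (T : Finset ι) :
    koszulSign R i T * koszulSign R i T = 1 := by
  rw [koszulSign, ← mul_pow]; simp

lemma koszulSign_insert {i j : ι} {T : Finset ι} (hj : j ∉ T) :
    koszulSign R i (insert j T) = if j < i then -koszulSign R i T else koszulSign R i T := by
  unfold koszulSign
  rw [filter_insert]
  split_ifs with h
  · rw [card_insert_of_notMem (by simp [hj]), pow_succ]; simp
  · rfl

lemma koszulSign_erase {i j : ι} {T : Finset ι} (hj : j ∈ T) :
    koszulSign R i (T.erase j) = if j < i then -koszulSign R i T else koszulSign R i T := by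
  have h := koszulSign_insert (R := R) (i := i) (notMem_erase j T)
  rw [insert_erase hj] at h
  split_ifs at h ⊢ <;> simp [h]

/-- The Koszul differential of the sequence `x`, on cochains indexed by finite subsets. -/
def koszulD (x : ι → R) (φ : Finset ι → M) (T : Finset ι) : M :=
  ∑ i ∈ T, (koszulSign R i T * x i) • φ (T.erase i)

/-- Contraction of Koszul cochains against `a`. -/
def koszulContract [Fintype ι] (a : ι → R) (φ : Finset ι → M) (T : Finset ι) : M :=
  ∑ i ∈ Tᶜ, (koszulSign R i T * a i) • φ (insert i T)

lemma koszulD_koszulD (x : ι → R) (φ : Finset ι → M) : koszulD x (koszulD x φ) = 0 := by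
  funext T
  simp only [koszulD, smul_sum, smul_smul, Pi.zero_apply]
  rw [sum_sigma']
  refine sum_involution (fun p _ => ⟨p.2, p.1⟩) ?_ ?_ ?_ ?_
  · rintro ⟨i, j⟩ h
    simp only [mem_sigma, mem_erase] at h
    obtain ⟨hi, hji, hj⟩ := h
    dsimp only
    rw [erase_right_comm, ← add_smul, koszulSign_erase hi, koszulSign_erase hj]
    rcases lt_or_gt_of_ne hji with h | h
    · rw [if_neg h.not_gt, if_pos h]; convert zero_smul R _; ring
    · rw [if_neg h.not_gt, if_pos h]; convert zero_smul R _; ring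
  · rintro ⟨i, j⟩ h _ h'
    simp only [mem_sigma, mem_erase] at h
    simp only [Sigma.mk.injEq, heq_eq_eq] at h'
    exact h.2.1 h'.1
  · rintro ⟨i, j⟩ h
    simp only [mem_sigma, mem_erase] at h ⊢
    exact ⟨h.2.2, h.2.1.symm, h.1⟩
  · rintro ⟨i, j⟩ _; rfl

lemma koszulD_contract_add_contract_D [Fintype ι] (x a : ι → R) (φ : Finset ι → M) :
    koszulD x (koszulContract a φ) + koszulContract a (koszulD x φ) =
      (∑ i, a i * x i) • φ := by
  funext T
  have h1 : koszulD x (koszulContract a φ) T = (∑ i ∈ T, a i * x i) • φ T +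
      ∑ i ∈ T, ∑ j ∈ Tᶜ, (koszulSign R i T * x i * (koszulSign R j (T.erase i) * a j)) •
        φ (insert j (T.erase i)) := by
    rw [sum_smul, ← sum_add_distrib, koszulD]
    refine sum_congr rfl fun i hi => ?_
    rw [koszulContract, compl_erase, sum_insert (by simp [hi]), smul_add, smul_smul, insert_erase hi,
      koszulSign_erase hi, if_neg (lt_irrefl _), smul_sum]
    simp only [smul_smul]
    congr 2
    linear_combination (a i * x i) * koszulSign_mul_self (R := R) i T
  have h2 : koszulContract a (koszulD x φ) T = (∑ i ∈ Tᶜ, a i * x i) • φ T +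
      ∑ j ∈ Tᶜ, ∑ i ∈ T, (koszulSign R j T * a j * (koszulSign R i (insert j T) * x i)) •
        φ ((insert j T).erase i) := by
    rw [sum_smul, ← sum_add_distrib, koszulContract]
    refine sum_congr rfl fun j hj => ?_
    rw [mem_compl] at hj
    rw [koszulD, sum_insert hj, smul_add, smul_smul, erase_insert hj,
      koszulSign_insert hj, if_neg (lt_irrefl _), smul_sum]
    simp only [smul_smul]
    congr 2
    linear_combination (a j * x j) * koszulSign_mul_self (R := R) j T
  rw [Pi.add_apply, h1, h2, sum_comm (s := Tᶜ), add_add_add_comm, ← add_smul, sum_add_sum_compl,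
    ← sum_add_distrib, Pi.smul_apply, add_eq_left]
  refine sum_eq_zero fun i hi => ?_
  rw [← sum_add_distrib]
  refine sum_eq_zero fun j hj => ?_
  rw [mem_compl] at hj
  have hij : i ≠ j := by rintro rfl; exact hj hi
  rw [erase_insert_of_ne hij.symm, ← add_smul, koszulSign_erase hi, koszulSign_insert hj]
  rcases lt_or_gt_of_ne hij with h | h
  · rw [if_neg h.not_gt, if_pos h]; convert zero_smul R _; ring
  · rw [if_neg h.not_gt, if_pos h]; convert zero_smul R _; ring

lemma koszulD_add (x : ι → R) (φ ψ : Finset ι → M) :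
    koszulD x (φ + ψ) = koszulD x φ + koszulD x ψ := by
  funext T; simp [koszulD, sum_add_distrib]

lemma koszulD_smul (x : ι → R) (r : R) (φ : Finset ι → M) :
    koszulD x (r • φ) = r • koszulD x φ := by
  funext T; simp [koszulD, smul_sum, smul_comm r]

lemma koszulD_comp {M' : Type*} [AddCommGroup M'] [Module R M'] (x : ι → R) (f : M →ₗ[R] M')
    (φ : Finset ι → M) : koszulD x (f ∘ φ) = f ∘ koszulD x φ := by
  funext T; simp [koszulD]

lemma koszulD_mem_smul_top (x : ι → R) (φ : Finset ι → M) (T : Finset ι) :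
    koszulD x φ T ∈ Ideal.span (Set.range x) • (⊤ : Submodule R M) :=
  Submodule.sum_mem _ fun i _ => Submodule.smul_mem_smul
    (Ideal.mul_mem_left _ _ (Ideal.subset_span ⟨i, rfl⟩)) trivial

/-- Koszul cohomology in degree `j` vanishes in the presence of a weakly regular sequence of
length greater than `j`. -/
lemma exists_eq_koszulD_of_isWeaklyRegular [Fintype ι] (x : ι → R) {rs : List R}
    (h : RingTheory.Sequence.IsWeaklyRegular M rs)
    (hrs : ∀ r ∈ rs, r ∈ Ideal.span (Set.range x)) {j : ℕ} (hj : j < rs.length)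
    {φ : Finset ι → M} (hφ : ∀ T, φ T ≠ 0 → #T = j) (hd : koszulD x φ = 0) :
    ∃ χ : Finset ι → M, φ = koszulD x χ := by
  induction rs generalizing M j with
  | nil => simp at hj
  | cons r rs ih =>
    rw [RingTheory.Sequence.isWeaklyRegular_cons_iff] at h
    obtain ⟨hr, hreg⟩ := h
    obtain ⟨a, ha⟩ := Ideal.mem_span_range_iff_exists_fun.1 (hrs r List.mem_cons_self)
    have hom := koszulD_contract_add_contract_D x a φ
    have hz : koszulContract a (0 : Finset ι → M) = 0 := by
      funext T; simp [koszulContract]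
    rw [hd, hz, add_zero, ha] at hom
    have hψ : ∀ T, koszulContract a φ T ≠ 0 → #T + 1 = j := by
      intro T hT
      obtain ⟨i, hi, hne⟩ := exists_ne_zero_of_sum_ne_zero hT
      have := hφ (insert i T) (right_ne_zero_of_smul hne)
      rwa [card_insert_of_notMem (mem_compl.1 hi)] at this
    cases j with
    | zero =>
      refine ⟨0, ?_⟩
      have h0 : koszulContract a φ = 0 := by
        funext T
        by_contra hT
        exact absurd (hψ T hT) (by simp)
      have hD0 : koszulD x (0 : Finset ι → M) = 0 := by funext T; simp [koszulD]
      rw [h0, hD0] at hom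
      rw [hD0]
      funext T
      exact hr.right_eq_zero_of_smul (congrFun hom T).symm
    | succ j =>
      let q : M →ₗ[R] QuotSMulTop r M := Submodule.mkQ _
      have hq0 : ∀ m : M, q (r • m) = 0 := fun m =>
        (Submodule.Quotient.mk_eq_zero _).2 (Submodule.smul_mem_pointwise_smul m r ⊤ trivial)
      obtain ⟨η, hη⟩ := ih hreg (fun s hs => hrs s (List.mem_cons_of_mem _ hs))
        (Nat.lt_of_succ_lt_succ hj) (φ := q ∘ koszulContract a φ)
        (fun T hT => Nat.succ_injective (hψ T fun h0 => hT (by simp [h0])))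
        (by
          rw [koszulD_comp, hom]
          funext T
          exact hq0 _)
      obtain ⟨η, rfl⟩ : ∃ η' : Finset ι → M, q ∘ η' = η :=
        ⟨fun T => (Submodule.mkQ_surjective _ (η T)).choose,
          funext fun T => (Submodule.mkQ_surjective _ (η T)).choose_spec⟩
      have hχ : ∀ T, ∃ m : M, koszulContract a φ T = koszulD x η T + r • m := by
        intro T
        have h1 : q (koszulContract a φ T - koszulD x η T) = 0 := by
          rw [map_sub, sub_eq_zero]
          have := congrFun hη T
          rwa [koszulD_comp] at this
        obtain ⟨m, -, hm⟩ := (Submodule.mem_smul_pointwise_iff_exists _ _ _).1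
          ((Submodule.Quotient.mk_eq_zero _).1 h1)
        exact ⟨m, by rw [hm]; abel⟩
      choose χ hχ using hχ
      refine ⟨χ, ?_⟩
      have hχ' : koszulContract a φ = koszulD x η + r • χ := funext hχ
      rw [hχ', koszulD_add, koszulD_koszulD, zero_add, koszulD_smul] at hom
      funext T
      exact hr (congrFun hom T).symm

end Koszul

section Monomials

variable {K : Type*} [Field K] {n : ℕ}

/-- The exponent vector of a squarefree monomial. -/
noncomputable def sqExp (T : Finset (Fin n)) : Fin n →₀ ℕ := ∑ i ∈ T, Finsupp.single i 1

lemma sqExp_apply (T : Finset (Fin n)) (i : Fin n) : sqExp T i = if i ∈ T then 1 else 0 := by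
  simp [sqExp, Finsupp.finsetSum_apply, Finsupp.single_apply]

lemma support_sqExp (T : Finset (Fin n)) : (sqExp T).support = T := by
  ext i; simp [sqExp_apply]

lemma sqExp_le_iff {T : Finset (Fin n)} {m : Fin n →₀ ℕ} : sqExp T ≤ m ↔ T ⊆ m.support := by
  refine ⟨fun h i hi => ?_, fun h i => ?_⟩
  · have := h i
    rw [sqExp_apply, if_pos hi] at this
    exact Finsupp.mem_support_iff.2 (by omega)
  · rw [sqExp_apply]
    split_ifs with hi
    · exact Nat.one_le_iff_ne_zero.2 (Finsupp.mem_support_iff.1 (h hi))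
    · exact Nat.zero_le _

lemma sqm_eq_monomial (T : Finset (Fin n)) : sqm K T = monomial (sqExp T) 1 := by
  rw [sqm, sqExp, monomial_sum_one]; rfl

lemma mem_span_sqm_iff {G : Set (Finset (Fin n))} {f : MvPolynomial (Fin n) K} :
    f ∈ Ideal.span (sqm K '' G) ↔ ∀ m ∈ f.support, ∃ T ∈ G, T ⊆ m.support := by
  have : sqm K '' G = (fun s => monomial s (1 : K)) '' (sqExp '' G) := by
    rw [Set.image_image]
    exact Set.image_congr fun T _ => sqm_eq_monomial T
  rw [this, mem_ideal_span_monomial_image]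
  simp [sqExp_le_iff]

lemma sqm_mem_span_sqm_iff {G : Set (Finset (Fin n))} {U : Finset (Fin n)} :
    sqm K U ∈ Ideal.span (sqm K '' G) ↔ ∃ T ∈ G, T ⊆ U := by
  classical
  rw [mem_span_sqm_iff, sqm_eq_monomial, support_monomial, if_neg one_ne_zero]
  simp [support_sqExp]

lemma sqm_insert {i : Fin n} {T : Finset (Fin n)} (h : i ∉ T) :
    sqm K (insert i T) = X i * sqm K T := by
  rw [sqm, Finset.prod_insert h, sqm]

lemma X_mul_sqm_erase {i : Fin n} {T : Finset (Fin n)} (h : i ∈ T) :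
    X i * sqm K (T.erase i) = sqm K T := by
  rw [← sqm_insert (Finset.notMem_erase i T), Finset.insert_erase h]

end Monomials

section LowerBound

open CategoryTheory Abelian RingTheory.Sequence

universe u

variable {K : Type u} [Field K] {n : ℕ}

/-- Variables outside the generators of a prime generated by variables form a weakly regular
sequence on the quotient. -/
lemma isWeaklyRegular_quotient_span_X (A : Set (Fin n)) (l : List (Fin n)) (hl : l.Nodup)
    (hA : ∀ i ∈ l, i ∉ A) :
    IsWeaklyRegular (MvPolynomial (Fin n) K ⧸ Ideal.span (X '' A : Set (MvPolynomial (Fin n) K)))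
      (l.map (X : Fin n → MvPolynomial (Fin n) K)) := by
  set P := Ideal.span (X '' A : Set (MvPolynomial (Fin n) K)) with hP
  rw [isWeaklyRegular_iff]
  intro i hi
  rw [isSMulRegular_quotient_iff_mem_of_smul_mem]
  have hi' : i < l.length := by simpa using hi
  have key : ∀ f : MvPolynomial (Fin n) K,
      (Ideal.Quotient.mk P f ∈ (Ideal.ofList ((l.map (X : Fin n → MvPolynomial (Fin n) K)).take i) •
        (⊤ : Submodule (MvPolynomial (Fin n) K) (MvPolynomial (Fin n) K ⧸ P)))) ↔
      f ∈ Ideal.span (X '' (A ∪ {j | j ∈ l.take i}) : Set (MvPolynomial (Fin n) K)) := by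
    intro f
    have h1 : (Ideal.ofList ((l.map (X : Fin n → MvPolynomial (Fin n) K)).take i) •
        (⊤ : Submodule (MvPolynomial (Fin n) K) (MvPolynomial (Fin n) K ⧸ P))) =
        Submodule.map P.mkQ (Ideal.ofList ((l.map (X : Fin n → MvPolynomial (Fin n) K)).take i)) := by
      rw [← Submodule.range_mkQ P, ← Submodule.map_top, ← Submodule.map_smul'']
      simp
    have h2 : Ideal.span (X '' (A ∪ {j | j ∈ l.take i}) : Set (MvPolynomial (Fin n) K)) =
        P ⊔ Ideal.ofList ((l.map (X : Fin n → MvPolynomial (Fin n) K)).take i) := by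
      rw [Set.image_union, Ideal.span_union, hP, Ideal.ofList]
      have : (X '' {j | j ∈ l.take i} : Set (MvPolynomial (Fin n) K)) =
          {r | r ∈ (l.map (X : Fin n → MvPolynomial (Fin n) K)).take i} := by
        ext g
        simp [← List.map_take]
      rw [this]
    rw [h1, h2]
    have : f ∈ Submodule.comap P.mkQ (Submodule.map P.mkQ (Ideal.ofList ((l.map (X : Fin n → MvPolynomial (Fin n) K)).take i))) ↔
        f ∈ P ⊔ Ideal.ofList ((l.map (X : Fin n → MvPolynomial (Fin n) K)).take i) := by
      rw [Submodule.comap_map_mkQ]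
    exact this
  intro f
  obtain ⟨f, rfl⟩ := Ideal.Quotient.mk_surjective f
  intro hf
  have hf' : (X l[i] : MvPolynomial (Fin n) K) * f ∈
      Ideal.span (X '' (A ∪ {j | j ∈ l.take i}) : Set (MvPolynomial (Fin n) K)) := by
    rw [← key]
    rw [List.getElem_map] at hf
    exact hf
  rw [key]
  rw [mem_ideal_span_X_image] at hf' ⊢
  intro m hm
  obtain ⟨j, hj, hjm⟩ := hf' (m + Finsupp.single l[i] 1) (by
    rw [mem_support_iff] at hm ⊢
    rwa [mul_comm, coeff_mul_X])
  refine ⟨j, hj, ?_⟩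
  have hne : l[i] ≠ j := by
    rintro rfl
    rcases hj with hj | hj
    · exact hA _ (List.getElem_mem hi') hj
    · obtain ⟨k, hk, hk'⟩ := List.mem_take_iff_getElem.1 hj
      have := (hl.getElem_inj_iff).1 hk'
      omega
  simpa [Finsupp.single_apply, hne] using hjm

/-- The irrelevant maximal ideal. -/
noncomputable abbrev irrel (K : Type u) [Field K] (n : ℕ) : Ideal (MvPolynomial (Fin n) K) :=
  Ideal.span (Set.range X)

lemma one_notMem_irrel : (1 : MvPolynomial (Fin n) K) ∉ irrel K n := by
  classical
  rw [irrel, ← Set.image_univ, mem_ideal_span_X_image]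
  intro h
  obtain ⟨i, -, hi⟩ := h 0 (by simp)
  simp at hi

lemma subsingleton_ext_quotient_span_X (T : Finset (Fin n)) {i : ℕ} (hi : i < T.card) :
    Subsingleton (Ext (ModuleCat.of (MvPolynomial (Fin n) K) (MvPolynomial (Fin n) K ⧸ irrel K n))
      (ModuleCat.of (MvPolynomial (Fin n) K) (MvPolynomial (Fin n) K ⧸
        Ideal.span (X '' {j | j ∉ T} : Set (MvPolynomial (Fin n) K)))) i) := by
  set P := Ideal.span (X '' {j | j ∉ T} : Set (MvPolynomial (Fin n) K)) with hP
  have hPm : P ≤ irrel K n := Ideal.span_mono (Set.image_subset_range _ _)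
  have htop : irrel K n • (⊤ : Submodule (MvPolynomial (Fin n) K) (MvPolynomial (Fin n) K ⧸ P))
      < ⊤ := by
    rw [lt_top_iff_ne_top]
    intro h
    have h1 : irrel K n • (⊤ : Submodule (MvPolynomial (Fin n) K) (MvPolynomial (Fin n) K ⧸ P)) =
        Submodule.map P.mkQ (irrel K n) := by
      rw [← Submodule.range_mkQ P, ← Submodule.map_top, ← Submodule.map_smul'']
      simp
    have h2 : (1 : MvPolynomial (Fin n) K) ∈
        Submodule.comap P.mkQ (Submodule.map P.mkQ (irrel K n)) := by
      rw [← h1, h]; trivial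
    rw [Submodule.comap_map_mkQ, sup_eq_right.2 hPm] at h2
    exact one_notMem_irrel h2
  have hmem : ∀ r ∈ T.toList.map (X : Fin n → MvPolynomial (Fin n) K), r ∈ irrel K n := by
    intro r hr
    obtain ⟨j, -, rfl⟩ := List.mem_map.1 hr
    exact Ideal.subset_span ⟨j, rfl⟩
  refine ModuleCat.subsingleton_ext_of_exists_isRegular (irrel K n) _ ?_ _ htop
    (T.toList.map X) hmem ⟨?_, ?_⟩ i (by simpa using hi)
  · change Module.support _ (MvPolynomial (Fin n) K ⧸ irrel K n) ⊆ _
    rw [Module.support_eq_zeroLocus, Ideal.annihilator_quotient]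
  · exact isWeaklyRegular_quotient_span_X _ _ T.nodup_toList (by simp)
  · intro h
    exact (htop.trans_eq h).not_ge (Submodule.smul_mono_left (Ideal.span_le.2 hmem))

/-- If `T` is a maximal squarefree monomial of `I \ J`, the sequence
`0 → S/(x_j : j ∉ T) → I/J → I/(J + x_T) → 0` is short exact. -/
lemma exists_exact_quotMod_insert {I : Ideal (MvPolynomial (Fin n) K)}
    {G : Set (Finset (Fin n))} {T : Finset (Fin n)}
    (hT : T ∈ sqPoset I (Ideal.span (sqm K '' G)))
    (hmax : ∀ j ∉ T, insert j T ∉ sqPoset I (Ideal.span (sqm K '' G))) :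
    ∃ (f : (MvPolynomial (Fin n) K ⧸ Ideal.span (X '' {j | j ∉ T} :
          Set (MvPolynomial (Fin n) K))) →ₗ[MvPolynomial (Fin n) K]
          quotMod I (Ideal.span (sqm K '' G)))
      (g : quotMod I (Ideal.span (sqm K '' G)) →ₗ[MvPolynomial (Fin n) K]
          quotMod I (Ideal.span (sqm K '' insert T G))),
      Function.Injective f ∧ Function.Surjective g ∧ Function.Exact f g := by
  classical
  set J := Ideal.span (sqm K '' G) with hJ
  set L := Ideal.span (sqm K '' insert T G) with hL
  have hLJ : L = Ideal.span {sqm K T} ⊔ J := by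
    rw [hL, Set.image_insert_eq, Ideal.span_insert]
  set P := Ideal.span (X '' {j | j ∉ T} : Set (MvPolynomial (Fin n) K)) with hP
  have hcolon : ∀ f, f * sqm K T ∈ J ↔ f ∈ P := by
    intro f
    constructor
    · intro hf
      rw [hP, mem_ideal_span_X_image]
      intro m hm
      obtain ⟨U, hU, hUm⟩ := mem_span_sqm_iff.1 hf (m + sqExp T) (by
        rw [sqm_eq_monomial, mem_support_iff, coeff_mul_monomial, mul_one]
        exact mem_support_iff.1 hm)
      have hnot : ¬ U ⊆ T := fun h => hT.2 (sqm_mem_span_sqm_iff.2 ⟨U, hU, h⟩)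
      obtain ⟨j, hjU, hjT⟩ := Finset.not_subset.1 hnot
      refine ⟨j, hjT, ?_⟩
      simpa [sqExp_apply, hjT] using hUm hjU
    · intro hf
      have : P ≤ Submodule.comap (LinearMap.mulRight (MvPolynomial (Fin n) K) (sqm K T)) J := by
        rw [hP, Ideal.span, Submodule.span_le]
        rintro _ ⟨j, hj, rfl⟩
        have hI : sqm K (insert j T) ∈ I := by
          rw [sqm_insert hj]; exact I.mul_mem_left _ hT.1
        have := hmax j hj
        change X j * sqm K T ∈ J
        rw [← sqm_insert hj]
        by_contra h
        exact this ⟨hI, h⟩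
      exact this hf
  let t : I := ⟨sqm K T, hT.1⟩
  have hPle : P ≤ (Submodule.comap I.subtype J).comap (LinearMap.toSpanSingleton _ I t) := by
    intro f hf
    exact (hcolon f).2 hf
  have hJLe : Submodule.comap I.subtype J ≤ (Submodule.comap I.subtype L).comap LinearMap.id := by
    intro f hf
    exact (hLJ ▸ le_sup_right : J ≤ L) hf
  refine ⟨Submodule.mapQ P (Submodule.comap I.subtype J) _ hPle,
    Submodule.mapQ (Submodule.comap I.subtype J) (Submodule.comap I.subtype L) LinearMap.id hJLe, ?_, ?_, ?_⟩
  · rw [injective_iff_map_eq_zero]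
    intro f hf
    obtain ⟨f, rfl⟩ := Submodule.Quotient.mk_surjective _ f
    rw [Submodule.mapQ_apply, Submodule.Quotient.mk_eq_zero] at hf
    exact (Submodule.Quotient.mk_eq_zero _).2 ((hcolon f).1 hf)
  · intro y
    obtain ⟨y, rfl⟩ := Submodule.Quotient.mk_surjective _ y
    exact ⟨Submodule.Quotient.mk y, rfl⟩
  · intro y
    obtain ⟨y, rfl⟩ := Submodule.Quotient.mk_surjective _ y
    rw [Submodule.mapQ_apply, Submodule.Quotient.mk_eq_zero]
    constructor
    · intro hy
      have hy' : (y : MvPolynomial (Fin n) K) ∈ Ideal.span {sqm K T} ⊔ J := hLJ ▸ hy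
      obtain ⟨a, ha, b, hb, hab⟩ := Submodule.mem_sup.1 hy'
      obtain ⟨c, rfl⟩ := Ideal.mem_span_singleton'.1 ha
      refine ⟨Submodule.Quotient.mk c, ?_⟩
      rw [Submodule.mapQ_apply, Submodule.Quotient.eq]
      change c * sqm K T - y ∈ J
      rw [← hab, sub_add_cancel_left]
      exact J.neg_mem hb
    · rintro ⟨f, hf⟩
      obtain ⟨f, rfl⟩ := Submodule.Quotient.mk_surjective _ f
      rw [Submodule.mapQ_apply, Submodule.Quotient.eq] at hf
      have hf : f * sqm K T - y ∈ J := hf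
      change (y : MvPolynomial (Fin n) K) ∈ L
      rw [hLJ]
      have : (y : MvPolynomial (Fin n) K) = f * sqm K T - (f * sqm K T - y) := by ring
      rw [this]
      exact Ideal.sub_mem _
        (Ideal.mem_sup_left (Ideal.mul_mem_left _ _ (Ideal.mem_span_singleton_self _)))
        (Ideal.mem_sup_right hf)

lemma subsingleton_ext_quotMod {d : ℕ} {H G : Set (Finset (Fin n))}
    (hd : ∀ T ∈ sqPoset (Ideal.span (sqm K '' H)) (Ideal.span (sqm K '' G)), d ≤ T.card)
    {i : ℕ} (hi : i < d) :
    Subsingleton (Ext (ModuleCat.of (MvPolynomial (Fin n) K) (MvPolynomial (Fin n) K ⧸ irrel K n))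
      (ModuleCat.of (MvPolynomial (Fin n) K)
        (quotMod (Ideal.span (sqm K '' H)) (Ideal.span (sqm K '' G)))) i) := by
  induction hk : (sqPoset (Ideal.span (sqm K '' H)) (Ideal.span (sqm K '' G))).ncard using
    Nat.strong_induction_on generalizing G with
  | _ k ih =>
    subst hk
    set I := Ideal.span (sqm K '' H) with hI
    rcases (sqPoset I (Ideal.span (sqm K '' G))).eq_empty_or_nonempty with he | hne
    · have hle : I ≤ Ideal.span (sqm K '' G) := by
        rw [hI, Ideal.span_le]
        rintro _ ⟨T, hT, rfl⟩
        by_contra h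
        have : T ∈ sqPoset I (Ideal.span (sqm K '' G)) :=
          ⟨Ideal.subset_span ⟨T, hT, rfl⟩, h⟩
        simp [he] at this
      have : Subsingleton (quotMod I (Ideal.span (sqm K '' G))) := by
        rw [Submodule.Quotient.subsingleton_iff, eq_top_iff]
        intro f _
        exact hle f.2
      have h0 : 𝟙 (ModuleCat.of (MvPolynomial (Fin n) K)
          (quotMod I (Ideal.span (sqm K '' G)))) = 0 :=
        (ModuleCat.isZero_of_subsingleton _).eq_of_src _ _
      refine subsingleton_of_forall_eq 0 fun α => ?_
      rw [← α.comp_mk₀_id, h0, Ext.mk₀_zero, Ext.comp_zero]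
    · obtain ⟨T, hT, hTmax⟩ := Set.exists_max_image _ Finset.card (Set.toFinite _) hne
      obtain ⟨f, g, hf, hg, hfg⟩ := exists_exact_quotMod_insert hT (fun j hj hmem => by
        have := hTmax _ hmem
        rw [Finset.card_insert_of_notMem hj] at this
        omega)
      have hsub : sqPoset I (Ideal.span (sqm K '' insert T G)) ⊂
          sqPoset I (Ideal.span (sqm K '' G)) := by
        refine ⟨fun U hU => ⟨hU.1, fun h => hU.2
          (Ideal.span_mono (Set.image_mono (Set.subset_insert _ _)) h)⟩, fun h => ?_⟩
        exact (h hT).2 (Ideal.subset_span ⟨T, Set.mem_insert _ _, rfl⟩)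
      have h3 := ih _ (Set.ncard_lt_ncard hsub (Set.toFinite _)) (G := insert T G)
        (fun U hU => hd U (hsub.1 hU)) rfl
      have h1 := subsingleton_ext_quotient_span_X (K := K) T (hi.trans_le (hd T hT))
      let C : ShortComplex (ModuleCat.{u} (MvPolynomial (Fin n) K)) :=
        ShortComplex.mk (ModuleCat.ofHom f) (ModuleCat.ofHom g) (by
          rw [← ModuleCat.ofHom_comp, hfg.linearMap_comp_eq_zero]; rfl)
      have hC : C.ShortExact :=
        { exact := (ShortComplex.ShortExact.moduleCat_exact_iff_function_exact C).2 hfg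
          mono_f := (ModuleCat.mono_iff_injective _).2 hf
          epi_g := (ModuleCat.epi_iff_surjective _).2 hg }
      exact AddCommGrpCat.subsingleton_of_isZero <| ShortComplex.Exact.isZero_of_both_zeros
        (Ext.covariant_sequence_exact₂' _ hC i)
        ((AddCommGrpCat.isZero_of_iff_subsingleton.2 h1).eq_zero_of_src _)
        ((AddCommGrpCat.isZero_of_iff_subsingleton.2 h3).eq_zero_of_tgt _)

end LowerBound

section Combinatorics

variable {K : Type*} [Field K] {n : ℕ}

open Finset

/-- A homogeneous linear system with fewer equations than unknowns has a nonzero solution. -/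
lemma exists_nonzero_solution {α : Type*} [DecidableEq α] {A N : Finset α} (h : #N < #A)
    (c : α → α → K) :
    ∃ y : α → K, (∀ T, y T ≠ 0 → T ∈ A) ∧ (∃ T, y T ≠ 0) ∧
      ∀ U ∈ N, ∑ T ∈ A, c U T * y T = 0 := by
  let Φ : (A → K) →ₗ[K] (N → K) := Matrix.mulVecLin (Matrix.of fun U T => c U T)
  have hker : LinearMap.ker Φ ≠ ⊥ := LinearMap.ker_ne_bot_of_finrank_lt (by simpa using h)
  obtain ⟨y, hy, hy0⟩ := (Submodule.ne_bot_iff _).1 hker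
  obtain ⟨T, hT⟩ := Function.ne_iff.1 hy0
  refine ⟨fun T => if hT : T ∈ A then y ⟨T, hT⟩ else 0, fun T hT => ?_, ⟨T, by simpa using hT⟩,
    fun U hU => ?_⟩
  · by_contra h'
    simp [h'] at hT
  · have := congrFun (LinearMap.mem_ker.1 hy) ⟨U, hU⟩
    rw [← sum_coe_sort]
    simpa [Φ, Matrix.mulVec, dotProduct] using this

lemma bddAbove_sdepth {I J : Ideal (MvPolynomial (Fin n) K)} (hne : (sqPoset I J).Nonempty) :
    BddAbove {k | ∃ F, IsIntervalPartition I J F ∧ ∀ p ∈ F, k ≤ p.2.card} := by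
  obtain ⟨T, hT⟩ := hne
  refine ⟨n, ?_⟩
  rintro k ⟨F, hF, hk⟩
  obtain ⟨p, ⟨hp, -⟩, -⟩ := hF.2 T hT
  exact (hk p hp).trans (card_finset_fin_le _)

/-- A matching of the degree `d` part of the poset into the degree `d + 1` part extends to an
interval partition. -/
lemma succ_le_sdepth_of_matching {I J : Ideal (MvPolynomial (Fin n) K)} {d : ℕ}
    (hne : (sqPoset I J).Nonempty) (hd : ∀ T ∈ sqPoset I J, d ≤ #T)
    (g : {T // T ∈ sqPoset I J ∧ #T = d} → Finset (Fin n)) (hg : Function.Injective g)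
    (hg' : ∀ t, g t ∈ sqPoset I J ∧ #(g t) = d + 1 ∧ t.1 ⊆ g t) : d + 1 ≤ sdepth I J := by
  classical
  refine le_csSup (bddAbove_sdepth hne)
    ⟨univ.filter fun p => (∃ t, p = (t.1, g t)) ∨
      (p.1 = p.2 ∧ p.1 ∈ sqPoset I J ∧ d + 1 ≤ #p.1 ∧ ∀ t, g t ≠ p.1), ⟨?_, ?_⟩, ?_⟩
  · rintro p hp
    rcases (mem_filter.1 hp).2 with ⟨t, rfl⟩ | ⟨h1, h2, -, -⟩
    · exact ⟨t.2.1, (hg' t).1, (hg' t).2.2⟩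
    · exact ⟨h2, h1 ▸ h2, h1.le⟩
  · intro T hT
    have hsup : ∀ t, #T ≠ d → T ⊆ g t → g t = T := fun t h1 h2 =>
      (eq_of_subset_of_card_le h2 (by have := hd T hT; have := (hg' t).2.1; omega)).symm
    by_cases hc : #T = d
    · refine ⟨(T, g ⟨T, hT, hc⟩),
        ⟨mem_filter.2 ⟨mem_univ _, Or.inl ⟨⟨T, hT, hc⟩, rfl⟩⟩, subset_rfl,
        (hg' ⟨T, hT, hc⟩).2.2⟩, ?_⟩
      rintro p ⟨hp, hp1, hp2⟩
      rcases (mem_filter.1 hp).2 with ⟨t, rfl⟩ | ⟨h1, -, h3, -⟩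
      · have : t.1 = T := eq_of_subset_of_card_le hp1 (by rw [hc, t.2.2])
        subst this
        rfl
      · have := card_le_card hp1
        omega
    · by_cases ht : ∃ t, g t = T
      · obtain ⟨t, rfl⟩ := ht
        refine ⟨(t.1, g t), ⟨mem_filter.2 ⟨mem_univ _, Or.inl ⟨t, rfl⟩⟩, (hg' t).2.2,
          subset_rfl⟩, ?_⟩
        rintro p ⟨hp, hp1, hp2⟩
        rcases (mem_filter.1 hp).2 with ⟨t', rfl⟩ | ⟨h1, -, -, h4⟩
        · rw [hg (hsup t' hc hp2)]
        · exact absurd (subset_antisymm (h1 ▸ hp2) hp1) (h4 t)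
      · push Not at ht
        have := hd T hT
        refine ⟨(T, T), ⟨mem_filter.2 ⟨mem_univ _, Or.inr ⟨rfl, hT, by dsimp only; omega, ht⟩⟩,
          subset_rfl, subset_rfl⟩, ?_⟩
        rintro ⟨p, q⟩ ⟨hp, hp1, hp2⟩
        rcases (mem_filter.1 hp).2 with ⟨t', h⟩ | ⟨h1, -, -, h4⟩
        · obtain ⟨rfl, rfl⟩ := Prod.mk.inj h
          exact absurd (hsup t' hc hp2) (ht t')
        · dsimp only at h1 hp1 hp2
          subst h1
          rw [subset_antisymm hp1 hp2]
  · rintro p hp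
    rcases (mem_filter.1 hp).2 with ⟨t, rfl⟩ | ⟨h1, -, h3, -⟩
    · exact (hg' t).2.1.ge
    · exact h1 ▸ h3

/-- If the Stanley depth is the initial degree `d`, Hall's condition fails between degrees `d`
and `d + 1`. -/
lemma exists_hall_violator {I J : Ideal (MvPolynomial (Fin n) K)} {d : ℕ}
    (hne : (sqPoset I J).Nonempty) (hd : ∀ T ∈ sqPoset I J, d ≤ #T) (hs : sdepth I J = d) :
    ∃ A N : Finset (Finset (Fin n)), #N < #A ∧ (∀ T ∈ A, T ∈ degSet I J d) ∧
      ∀ U ∈ degSet I J (d + 1), ∀ T ∈ A, T ⊆ U → U ∈ N := by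
  classical
  have hall := Fintype.all_card_le_filter_rel_iff_exists_injective
    (fun (t : {T // T ∈ sqPoset I J ∧ #T = d}) (U : Finset (Fin n)) =>
      U ∈ sqPoset I J ∧ #U = d + 1 ∧ t.1 ⊆ U)
  by_contra hcon
  obtain ⟨g, hg, hg'⟩ := hall.1 fun A => by
    by_contra hlt
    refine hcon ⟨A.map (Function.Embedding.subtype _),
      univ.filter fun U => ∃ t ∈ A, U ∈ sqPoset I J ∧ #U = d + 1 ∧ t.1 ⊆ U,
      by rw [card_map]; exact not_le.1 hlt, ?_, ?_⟩
    · intro T hT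
      obtain ⟨t, -, rfl⟩ := mem_map.1 hT
      exact t.2
    · intro U hU T hT hTU
      obtain ⟨t, ht, rfl⟩ := mem_map.1 hT
      exact mem_filter.2 ⟨mem_univ _, t, ht, hU.1, hU.2, hTU⟩
  have := succ_le_sdepth_of_matching hne hd g hg hg'
  omega

end Combinatorics

section UpperBound

variable {K : Type*} [Field K] {n : ℕ}

open Finset

/-- A squarefree monomial of the initial degree of `I` that is not in `J` is a minimal generator
of `I/J`. -/
lemma mk_sqm_notMem_smul_top {H G : Set (Finset (Fin n))} {T : Finset (Fin n)}
    (hH : ∀ U ∈ H, #T ≤ #U) (hTI : sqm K T ∈ Ideal.span (sqm K '' H))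
    (hTJ : sqm K T ∉ Ideal.span (sqm K '' G)) :
    (Submodule.Quotient.mk ⟨sqm K T, hTI⟩ :
      quotMod (Ideal.span (sqm K '' H)) (Ideal.span (sqm K '' G))) ∉
      (Ideal.span (Set.range X) : Ideal (MvPolynomial (Fin n) K)) •
        (⊤ : Submodule (MvPolynomial (Fin n) K) _) := by
  classical
  set I := Ideal.span (sqm K '' H) with hI
  set J := Ideal.span (sqm K '' G) with hJ
  have key : ∀ z ∈ (Ideal.span (Set.range X) : Ideal (MvPolynomial (Fin n) K)) •
      (⊤ : Submodule (MvPolynomial (Fin n) K) (quotMod I J)),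
      ∃ f : I, Submodule.Quotient.mk f = z ∧
        coeff (sqExp T) (f : MvPolynomial (Fin n) K) = 0 := by
    intro z hz
    refine Submodule.smul_induction_on hz ?_ ?_
    · intro r hr m _
      obtain ⟨f, rfl⟩ := Submodule.Quotient.mk_surjective _ m
      refine ⟨r • f, rfl, ?_⟩
      change coeff (sqExp T) (r * (f : MvPolynomial (Fin n) K)) = 0
      rw [coeff_mul]
      refine sum_eq_zero ?_
      rintro ⟨a, b⟩ hab
      rw [HasAntidiagonal.mem_antidiagonal] at hab
      dsimp only at hab ⊢
      by_contra hne
      obtain ⟨U, hU, hUb⟩ := mem_span_sqm_iff.1 f.2 b (mem_support_iff.2 (right_ne_zero_of_mul hne))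
      have hbT : b.support ⊆ T := by
        rw [← support_sqExp T]
        exact Finsupp.support_mono (hab ▸ le_add_self)
      have hUT : U = T := eq_of_subset_of_card_le (hUb.trans hbT) (hH U hU)
      have hle : sqExp T ≤ b := sqExp_le_iff.2 (hUT ▸ hUb)
      have ha : a = 0 := by
        rw [← hab] at hle
        simpa using hle
      subst ha
      rw [← Set.image_univ, mem_ideal_span_X_image] at hr
      obtain ⟨i, -, hi⟩ := hr 0 (mem_support_iff.2 (left_ne_zero_of_mul hne))
      exact hi rfl
    · rintro _ _ ⟨f, rfl, hf⟩ ⟨g, rfl, hg⟩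
      exact ⟨f + g, rfl, by simp [hf, hg]⟩
  intro h
  obtain ⟨f, hf, hf0⟩ := key _ h
  rw [eq_comm, Submodule.Quotient.eq] at hf
  have hf : sqm K T - f ∈ J := hf
  obtain ⟨U, hU, hUT⟩ := mem_span_sqm_iff.1 hf (sqExp T) (by
    rw [mem_support_iff, coeff_sub, hf0, sqm_eq_monomial, coeff_monomial, if_pos rfl]
    simp)
  rw [support_sqExp] at hUT
  exact hTJ (sqm_mem_span_sqm_iff.2 ⟨U, hU, hUT⟩)

/-- A failure of Hall's condition between degrees `d` and `d + 1` gives a nonzero Koszul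
cohomology class in degree `d`, hence bounds the length of regular sequences. -/
lemma length_le_of_isWeaklyRegular_quotMod {H G : Set (Finset (Fin n))} {d : ℕ}
    (hH : ∀ U ∈ H, d ≤ #U) {A N : Finset (Finset (Fin n))} (hlt : #N < #A)
    (hA : ∀ T ∈ A, T ∈ degSet (Ideal.span (sqm K '' H)) (Ideal.span (sqm K '' G)) d)
    (hN : ∀ U ∈ degSet (Ideal.span (sqm K '' H)) (Ideal.span (sqm K '' G)) (d + 1),
      ∀ T ∈ A, T ⊆ U → U ∈ N)
    {rs : List (MvPolynomial (Fin n) K)} (hrs : ∀ r ∈ rs, r ∈ Ideal.span (Set.range X))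
    (hreg : RingTheory.Sequence.IsWeaklyRegular
      (quotMod (Ideal.span (sqm K '' H)) (Ideal.span (sqm K '' G))) rs) :
    rs.length ≤ d := by
  classical
  set I := Ideal.span (sqm K '' H) with hI
  set J := Ideal.span (sqm K '' G) with hJ
  by_contra hlen
  push Not at hlen
  obtain ⟨y, hyA, ⟨T, hyT⟩, hy⟩ := exists_nonzero_solution hlt
    (fun U T => ∑ i ∈ U, if U.erase i = T then koszulSign K i U else 0)
  have hy' : ∀ U ∈ N, ∑ i ∈ U, koszulSign K i U * y (U.erase i) = 0 := by
    intro U hU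
    rw [← hy U hU]
    simp only [sum_mul, ite_mul, zero_mul]
    rw [sum_comm]
    refine sum_congr rfl fun i _ => ?_
    rw [sum_ite_eq]
    split_ifs with h
    · rfl
    · rw [not_imp_comm.1 (hyA _) h, mul_zero]
  let e : Finset (Fin n) → quotMod I J := fun T =>
    if h : sqm K T ∈ I then Submodule.Quotient.mk ⟨sqm K T, h⟩ else 0
  have he : ∀ T (h : sqm K T ∈ I), e T = Submodule.Quotient.mk ⟨sqm K T, h⟩ :=
    fun T h => dif_pos h
  have heX : ∀ U, ∀ i ∈ U, sqm K (U.erase i) ∈ I →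
      (X i : MvPolynomial (Fin n) K) • e (U.erase i) = e U := by
    intro U i hi h
    have hU : sqm K U ∈ I := by
      rw [← X_mul_sqm_erase hi]
      exact I.mul_mem_left _ h
    rw [he _ h, he _ hU, ← Submodule.Quotient.mk_smul]
    congr 1
    exact Subtype.ext (X_mul_sqm_erase hi)
  let φ : Finset (Fin n) → quotMod I J := fun T => (C (y T) : MvPolynomial (Fin n) K) • e T
  have hφ : ∀ T, φ T ≠ 0 → #T = d := fun T hT =>
    (hA T (hyA T fun h0 => hT (by simp [φ, h0]))).2
  have hd : koszulD (X : Fin n → MvPolynomial (Fin n) K) φ = 0 := by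
    funext U
    have hsum : koszulD (X : Fin n → MvPolynomial (Fin n) K) φ U =
        (C (∑ i ∈ U, koszulSign K i U * y (U.erase i)) : MvPolynomial (Fin n) K) • e U := by
      rw [koszulD, map_sum, sum_smul]
      refine sum_congr rfl fun i hi => ?_
      by_cases h0 : y (U.erase i) = 0
      · simp [φ, h0]
      · rw [← heX U i hi (hA _ (hyA _ h0)).1.1]
        simp only [φ, smul_smul, koszulSign, map_mul, map_pow, map_neg, map_one]
        congr 1
        ring
    rw [hsum, Pi.zero_apply]
    by_cases hUN : U ∈ N
    · rw [hy' U hUN, map_zero, zero_smul]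
    by_cases hUy : ∃ i ∈ U, y (U.erase i) ≠ 0
    · obtain ⟨i, hi, hyi⟩ := hUy
      have hmem := hA _ (hyA _ hyi)
      have hUI : sqm K U ∈ I := by
        rw [← X_mul_sqm_erase hi]
        exact I.mul_mem_left _ hmem.1.1
      have hUJ : sqm K U ∈ J := by
        by_contra hUJ
        refine hUN (hN U ⟨⟨hUI, hUJ⟩, ?_⟩ _ (hyA _ hyi) (erase_subset _ _))
        rw [← hmem.2, card_erase_add_one hi]
      have : e U = 0 := by
        rw [he U hUI]
        exact (Submodule.Quotient.mk_eq_zero _).2 hUJ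
      rw [this, smul_zero]
    · push Not at hUy
      rw [sum_eq_zero fun i hi => by rw [hUy i hi, mul_zero], map_zero, zero_smul]
  obtain ⟨χ, hχ⟩ := exists_eq_koszulD_of_isWeaklyRegular X hreg hrs hlen hφ hd
  have hTA := hA T (hyA T hyT)
  have hmem : e T ∈ (Ideal.span (Set.range X) : Ideal (MvPolynomial (Fin n) K)) •
      (⊤ : Submodule (MvPolynomial (Fin n) K) (quotMod I J)) := by
    have h1 : e T = (C (y T)⁻¹ : MvPolynomial (Fin n) K) • φ T := by
      simp only [φ, smul_smul]
      rw [← C_mul, inv_mul_cancel₀ hyT, C_1, one_smul]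
    rw [h1, hχ]
    exact Submodule.smul_mem _ _ (koszulD_mem_smul_top _ _ _)
  rw [he T hTA.1.1] at hmem
  exact mk_sqm_notMem_smul_top (fun U hU => hTA.2 ▸ hH U hU) hTA.1.1 hTA.1.2 hmem

end UpperBound

/-- if `sdepth I/J = d` then `depth I/J = d`. -/
theorem statement9 {K : Type*} [Field K] {n : ℕ} (d : ℕ) (hd : 0 < d)
    (I J : Ideal (MvPolynomial (Fin n) K)) (hJI : J < I)
    (hI : SqfreeGenFrom I d) (hJ : SqfreeGenFrom J (d + 1))
    (hsd : sdepth I J = d) :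
    depthIJ I J = d := by
  obtain ⟨H, hH, rfl⟩ := hI
  obtain ⟨G, -, rfl⟩ := hJ
  have hdeg : ∀ T ∈ sqPoset (Ideal.span (sqm K '' H)) (Ideal.span (sqm K '' G)), d ≤ T.card := by
    intro T hT
    obtain ⟨U, hU, hUT⟩ := sqm_mem_span_sqm_iff.1 hT.1
    exact (hH U hU).trans (Finset.card_le_card hUT)
  have hne : (sqPoset (Ideal.span (sqm K '' H)) (Ideal.span (sqm K '' G))).Nonempty := by
    by_contra he
    refine hJI.not_ge (Ideal.span_le.2 ?_)
    rintro _ ⟨T, hT, rfl⟩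
    by_contra h
    exact he ⟨T, Ideal.subset_span ⟨T, hT, rfl⟩, h⟩
  obtain ⟨A, N, hlt, hA, hN⟩ := exists_hall_violator hne hdeg hsd
  refine IsGreatest.csSup_eq ⟨?_, ?_⟩
  · obtain ⟨T, hT⟩ := Finset.card_pos.1 (Nat.zero_lt_of_lt hlt)
    have hT := hA T hT
    refine ModuleCat.exists_isRegular_of_exists_subsingleton_ext (irrel K n) d
      (ModuleCat.of _ (quotMod (Ideal.span (sqm K '' H)) (Ideal.span (sqm K '' G)))) ?_
      (ModuleCat.of _ (MvPolynomial (Fin n) K ⧸ irrel K n)) ?_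
      fun i hi => subsingleton_ext_quotMod hdeg hi
    · rw [lt_top_iff_ne_top]
      intro h
      refine mk_sqm_notMem_smul_top (fun U hU => hT.2 ▸ hH U hU) hT.1.1 hT.1.2 ?_
      exact h.ge Submodule.mem_top
    · change Module.support _ (MvPolynomial (Fin n) K ⧸ irrel K n) = _
      rw [Module.support_eq_zeroLocus, Ideal.annihilator_quotient]
  · rintro k ⟨rs, rfl, hrs, hreg⟩
    exact length_le_of_isWeaklyRegular_quotMod hH hlt hA hN hrs hreg.toIsWeaklyRegular
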